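/- arXiv:0712.1275 — 2 statements merged into one kernel-verified Lean document; each statement's English description precedes it below -/
import Mathlib

section
/- For each b ∈ ℝ, it is almost certain that the level set L_ω(b) := {t ∈ [0,∞) : ω(t) = b} is a perfect subset of [0,∞) (closed with no isolated points), and hence is either empty or has the cardinality of the continuum; that is, the set of ω ∈ Ω for which this fails is null. -/
open Filter Topology MeasureTheory
open scoped ENNReal NNReal

namespace GTP

/-- The sample space `Ω`: all continuous functions `ω : [0,∞) → ℝ`. -/
def Omega : Type := {f : ℝ≥0 → ℝ // Continuous f}

/-- The filtration: `F t` is the smallest σ-algebra on `Ω` making all maps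
`ω ↦ ω s`, `s ∈ [0,t]`, measurable. -/
def F (t : ℝ≥0) : MeasurableSpace Omega :=
  ⨆ s : {s : ℝ≥0 // s ≤ t},
    MeasurableSpace.comap (fun ω : Omega => ω.1 s.1) inferInstance

/-- A stopping time relative to the filtration `(F t)`, with values in `[0,∞]`. -/
def IsStopping (τ : Omega → ℝ≥0∞) : Prop :=
  ∀ t : ℝ≥0, MeasurableSet[F t] {ω : Omega | τ ω ≤ (t : ℝ≥0∞)}

/-- `F_τ`-measurability of a function `h : Ω → ℝ`. -/
def MeasurableAtTime (τ : Omega → ℝ≥0∞) (h : Omega → ℝ) : Prop :=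
  ∀ B : Set ℝ, MeasurableSet B → ∀ t : ℝ≥0,
    MeasurableSet[F t] (h ⁻¹' B ∩ {ω : Omega | τ ω ≤ (t : ℝ≥0∞)})

/-- An elementary trading strategy: an increasing sequence of stopping times
`τ₁ ≤ τ₂ ≤ ⋯` tending to `∞`, together with bounded `F_{τ_n}`-measurable
portfolio functions `h_n`. -/
structure ElemStrategy where
  τ : ℕ → Omega → ℝ≥0∞
  stopping : ∀ n, IsStopping (τ n)
  mono : ∀ n ω, τ n ω ≤ τ (n + 1) ω
  tendsto_top : ∀ ω, Tendsto (fun n => τ n ω) atTop (𝓝 ⊤)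
  h : ℕ → Omega → ℝ
  h_bdd : ∀ n, ∃ C : ℝ, ∀ ω, |h n ω| ≤ C
  h_meas : ∀ n, MeasurableAtTime (τ n) (h n)

/-- The time `τ ∧ t` as an element of `[0,∞)`. -/
noncomputable def clip (τ : Omega → ℝ≥0∞) (t : ℝ≥0) (ω : Omega) : ℝ≥0 :=
  (min (τ ω) (t : ℝ≥0∞)).toNNReal

/-- The elementary capital process
`K_t(ω) := c + Σ_n h_n(ω) (ω(τ_{n+1} ∧ t) − ω(τ_n ∧ t))`. -/
noncomputable def elemCapital (G : ElemStrategy) (c : ℝ) (t : ℝ≥0) (ω : Omega) : ℝ :=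
  c + ∑' n : ℕ, G.h n ω * (ω.1 (clip (G.τ (n + 1)) t ω) - ω.1 (clip (G.τ n) t ω))

/-- A positive capital process: a countable sum of nonnegative elementary capital
processes with strictly positive summable initial capitals. -/
structure PosCapital where
  G : ℕ → ElemStrategy
  c : ℕ → ℝ
  c_pos : ∀ n, 0 < c n
  c_summable : Summable c
  nonneg : ∀ n t ω, 0 ≤ elemCapital (G n) (c n) t ω

/-- The value `S_t(ω) ∈ [0,∞]` of a positive capital process. -/
noncomputable def PosCapital.value (S : PosCapital) (t : ℝ≥0) (ω : Omega) : ℝ≥0∞ :=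
  ∑' n : ℕ, ENNReal.ofReal (elemCapital (S.G n) (S.c n) t ω)

/-- The initial value `S_0` of a positive capital process (independent of `ω`,
since `K^{G_n,c_n}_0 = c_n`). -/
noncomputable def PosCapital.init (S : PosCapital) : ℝ≥0∞ :=
  ∑' n : ℕ, ENNReal.ofReal (S.c n)

/-- Upper probability:
`UpProb(E) := inf { S₀ : S a positive capital process, liminf_{t→∞} S_t ≥ 1_E }`. -/
noncomputable def UpProb (E : Set Omega) : ℝ≥0∞ :=
  ⨅ (S : PosCapital) (_ : ∀ ω : Omega,
      E.indicator (fun _ => (1 : ℝ≥0∞)) ω ≤ liminf (fun t : ℝ≥0 => S.value t ω) atTop),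
    S.init

/-- A set is null if its upper probability is `0`. -/
def IsNull (E : Set Omega) : Prop := UpProb E = 0

/-- After time `q`, the path has visited `b` before `r` and `g (ω r) = 0`. -/
def Vis (q : ℝ≥0) (b : ℝ) (g : ℝ → ℝ) (ω : Omega) (r : ℝ≥0) : Prop :=
  ∃ s, q ≤ s ∧ s ≤ r ∧ ω.1 s = b ∧ g (ω.1 r) = 0

noncomputable def hit (q : ℝ≥0) (b : ℝ) (g : ℝ → ℝ) (ω : Omega) : ℝ≥0∞ :=
  ⨅ (r : ℝ≥0) (_ : Vis q b g ω r), (r : ℝ≥0∞)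

lemma Vis.least {q : ℝ≥0} {b : ℝ} {g : ℝ → ℝ} (hg : Continuous g) {ω : Omega} {r : ℝ≥0}
    (h : Vis q b g ω r) : ∃ r₀, Vis q b g ω r₀ ∧ ∀ r', Vis q b g ω r' → r₀ ≤ r' := by
  have hω := ω.2
  let Z : Set (ℝ≥0 × ℝ≥0) := {p | q ≤ p.1 ∧ p.1 ≤ p.2 ∧ ω.1 p.1 = b ∧ g (ω.1 p.2) = 0}
  have hZ : IsClosed Z := by
    refine (isClosed_le continuous_const continuous_fst).inter
      ((isClosed_le continuous_fst continuous_snd).inter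
      ((isClosed_eq (hω.comp continuous_fst) continuous_const).inter
      (isClosed_eq (hg.comp (hω.comp continuous_snd)) continuous_const)))
  have hK : IsCompact (Prod.snd '' (Set.Icc ((0:ℝ≥0), (0:ℝ≥0)) (r, r) ∩ Z)) :=
    (isCompact_Icc.inter_right hZ).image continuous_snd
  obtain ⟨s, h1, h2, h3, h4⟩ := h
  obtain ⟨r₀, ⟨⟨a, c⟩, ⟨_, k1, k2, k3, k4⟩, rfl⟩, hmin⟩ := hK.exists_isLeast
    ⟨r, (s, r), ⟨⟨⟨zero_le, zero_le⟩, ⟨h2, le_refl r⟩⟩, h1, h2, h3, h4⟩, rfl⟩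
  refine ⟨c, ⟨a, k1, k2, k3, k4⟩, ?_⟩
  rintro r' ⟨s', l1, l2, l3, l4⟩
  rcases le_total r r' with hr | hr
  · exact le_trans (hmin ⟨(s, r), ⟨⟨⟨zero_le, zero_le⟩, ⟨h2, le_refl r⟩⟩, h1, h2, h3, h4⟩, rfl⟩) hr
  · exact hmin ⟨(s', r'), ⟨⟨⟨zero_le, zero_le⟩, ⟨l2.trans hr, hr⟩⟩, l1, l2, l3, l4⟩, rfl⟩

lemma hit_eq {q : ℝ≥0} {b : ℝ} {g : ℝ → ℝ} {ω : Omega} {r₀ : ℝ≥0}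
    (h : Vis q b g ω r₀) (hm : ∀ r', Vis q b g ω r' → r₀ ≤ r') : hit q b g ω = r₀ := by
  apply le_antisymm
  · exact iInf₂_le r₀ h
  · refine le_iInf₂ fun r' h' => ?_
    exact_mod_cast hm r' h'

lemma hit_le_iff {q : ℝ≥0} {b : ℝ} {g : ℝ → ℝ} (hg : Continuous g) {ω : Omega} {t : ℝ≥0} :
    hit q b g ω ≤ t ↔ ∃ r, r ≤ t ∧ Vis q b g ω r := by
  constructor
  · intro h
    by_cases hv : ∃ r, Vis q b g ω r
    · obtain ⟨r, hr⟩ := hv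
      obtain ⟨r₀, h0, hm⟩ := hr.least hg
      rw [hit_eq h0 hm] at h
      exact ⟨r₀, by exact_mod_cast h, h0⟩
    · push Not at hv
      have : hit q b g ω = ⊤ := by simp [hit, hv]
      rw [this] at h
      simp at h
  · rintro ⟨r, hr, hv⟩
    exact (iInf₂_le r hv).trans (by exact_mod_cast hr)

lemma meas_eval {s t : ℝ≥0} (h : s ≤ t) : Measurable[F t] (fun ω : Omega => ω.1 s) := by
  apply Measurable.mono (ma := MeasurableSpace.comap (fun ω : Omega => ω.1 s) inferInstance)
    (mb := inferInstance) (comap_measurable _) _ le_rfl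
  exact le_iSup (fun s : {s : ℝ≥0 // s ≤ t} =>
    MeasurableSpace.comap (fun ω : Omega => ω.1 s.1) inferInstance) ⟨s, h⟩

lemma isStopping_hit (q : ℝ≥0) (b : ℝ) {g : ℝ → ℝ} (hg : Continuous g) :
    IsStopping (hit q b g) := by
  intro t
  let Ks : Set (ℝ≥0 × ℝ≥0) := {p | q ≤ p.1 ∧ p.1 ≤ p.2 ∧ p.2 ≤ t}
  have hKc : IsCompact Ks := by
    have : Ks = Set.Icc ((0:ℝ≥0), (0:ℝ≥0)) (t, t) ∩ Ks := by
      ext ⟨x, y⟩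
      constructor
      · intro h
        exact ⟨⟨⟨zero_le, zero_le⟩, ⟨h.2.1.trans h.2.2, h.2.2⟩⟩, h⟩
      · exact fun h => h.2
    rw [this]
    refine isCompact_Icc.inter_right ?_
    have c1 : IsClosed {p : ℝ≥0 × ℝ≥0 | q ≤ p.1} := isClosed_le continuous_const continuous_fst
    have c2 : IsClosed {p : ℝ≥0 × ℝ≥0 | p.1 ≤ p.2} := isClosed_le continuous_fst continuous_snd
    have c3 : IsClosed {p : ℝ≥0 × ℝ≥0 | p.2 ≤ t} := isClosed_le continuous_snd continuous_const
    exact c1.inter (c2.inter c3)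
  have : CompactSpace Ks := isCompact_iff_compactSpace.mp hKc
  let f : Omega → Ks → ℝ := fun ω p => |ω.1 p.1.1 - b| + |g (ω.1 p.1.2)|
  have hfc : ∀ ω, Continuous (f ω) := by
    intro ω
    have hω : Continuous ω.1 := ω.2
    fun_prop
  have hfm : ∀ p, Measurable[F t] (fun ω => f ω p) := by
    intro p
    have h1 : Measurable[F t] (fun ω : Omega => ω.1 p.1.1) :=
      meas_eval (p.2.2.1.trans p.2.2.2)
    have h2 : Measurable[F t] (fun ω : Omega => ω.1 p.1.2) := meas_eval p.2.2.2
    have k1 : Measurable (fun x : ℝ => |x - b|) := by fun_prop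
    have k2 : Measurable (fun x : ℝ => |g x|) := by fun_prop
    exact Measurable.add (m := F t) (k1.comp h1) (k2.comp h2)
  obtain ⟨D, hDc, hDd⟩ := TopologicalSpace.exists_countable_dense Ks
  have key : {ω : Omega | hit q b g ω ≤ (t : ℝ≥0∞)} =
      ⋂ n : ℕ, ⋃ p ∈ D, {ω | f ω p < 1 / ((n : ℝ) + 1)} := by
    ext ω
    simp only [Set.mem_ofPred_eq, Set.mem_iInter, Set.mem_iUnion]
    rw [hit_le_iff hg]
    constructor
    · rintro ⟨r, hr, s, h1, h2, h3, h4⟩ n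
      have hopen : IsOpen {p | f ω p < 1 / ((n : ℝ) + 1)} :=
        isOpen_lt (hfc ω) continuous_const
      obtain ⟨p, hpD, hp⟩ := hDd.exists_mem_open hopen
        ⟨⟨(s, r), h1, h2, hr⟩, by
          simp only [Set.mem_ofPred_eq, f, h3, h4]; simp; positivity⟩
      exact ⟨p, hpD, hp⟩ 
    · intro h
      obtain ⟨p0, -, -⟩ := h 0
      obtain ⟨p, -, hp⟩ := isCompact_univ.exists_isMinOn ⟨p0, Set.mem_univ _⟩ (hfc ω).continuousOn
      have hle : f ω p ≤ 0 := by
        by_contra hlt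
        push Not at hlt
        obtain ⟨n, hn⟩ := exists_nat_one_div_lt hlt
        obtain ⟨p', -, hp'⟩ := h n
        have := hp (Set.mem_univ p')
        simp only [Set.mem_ofPred_eq] at this
        linarith
      have e1 := abs_nonneg (ω.1 p.1.1 - b)
      have e2 := abs_nonneg (g (ω.1 p.1.2))
      simp only [f] at hle
      refine ⟨p.1.2, p.2.2.2, p.1.1, p.2.1, p.2.2.1, ?_, ?_⟩
      · have : |ω.1 p.1.1 - b| = 0 := by linarith
        linarith [abs_eq_zero.mp this]
      · exact abs_eq_zero.mp (by linarith)
  rw [key]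
  refine MeasurableSet.iInter fun n => MeasurableSet.biUnion hDc fun p _ => ?_
  exact hfm p measurableSet_Iio

/-- Stopping function: zero iff `h (x-b) = 1` or `h (x-b) = -ε`. -/
def gfun (b h ε : ℝ) (x : ℝ) : ℝ := (h * (x - b) - 1) * (h * (x - b) + ε)

lemma gfun_cont (b h ε : ℝ) : Continuous (gfun b h ε) := by
  unfold gfun; fun_prop

lemma measAt_const (τ : Omega → ℝ≥0∞) (hτ : IsStopping τ) (c : ℝ) :
    MeasurableAtTime τ (fun _ => c) := by
  intro B _ t
  by_cases hc : c ∈ B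
  · simpa [Set.preimage_const_of_mem hc] using hτ t
  · rw [Set.preimage_const_of_notMem hc, Set.empty_inter]
    exact @MeasurableSet.empty _ (F t)

noncomputable def times (q : ℝ≥0) (b h ε : ℝ) : ℕ → Omega → ℝ≥0∞
  | 0 => hit q b (fun _ => 0)
  | 1 => hit q b (gfun b h ε)
  | _ => fun _ => ⊤

lemma times_stopping (q : ℝ≥0) (b h ε : ℝ) : ∀ n, IsStopping (times q b h ε n)
  | 0 => isStopping_hit q b continuous_const
  | 1 => isStopping_hit q b (gfun_cont b h ε)
  | (n + 2) => by
    intro t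
    simp [times]

noncomputable def strat (q : ℝ≥0) (b h ε : ℝ) : ElemStrategy where
  τ := times q b h ε
  stopping := times_stopping q b h ε
  mono := by
    intro n ω
    match n with
    | 0 =>
      refine le_iInf₂ fun r hr => ?_
      obtain ⟨s, h1, h2, h3, h4⟩ := hr
      exact iInf₂_le r ⟨s, h1, h2, h3, rfl⟩
    | (n + 1) => exact le_top
  tendsto_top := by
    intro ω
    apply tendsto_const_nhds.congr'
    filter_upwards [eventually_ge_atTop 2] with n hn
    obtain ⟨k, rfl⟩ := Nat.exists_eq_add_of_le' hn
    rfl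
  h := fun n _ => if n = 0 then h else 0
  h_bdd := fun n => ⟨|if n = 0 then h else 0|, fun _ => le_rfl⟩
  h_meas := fun n => measAt_const _ (times_stopping q b h ε n) _

lemma strat_capital (q : ℝ≥0) (b h ε : ℝ) (t : ℝ≥0) (ω : Omega) :
    elemCapital (strat q b h ε) ε t ω = ε + h * (ω.1 (clip (hit q b (gfun b h ε)) t ω)
      - ω.1 (clip (hit q b (fun _ => 0)) t ω)) := by
  unfold elemCapital
  rw [tsum_eq_single 0]
  · simp [strat, times]
  · intro n hn
    simp [strat, hn]

lemma clip_of_le {τ : Omega → ℝ≥0∞} {t : ℝ≥0} {ω : Omega} (h : (t : ℝ≥0∞) ≤ τ ω) :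
    clip τ t ω = t := by
  simp [clip, min_eq_right h]

lemma clip_of_eq {τ : Omega → ℝ≥0∞} {t r : ℝ≥0} {ω : Omega} (h : τ ω = r) (hr : r ≤ t) :
    clip τ t ω = r := by
  have : (r : ℝ≥0∞) ≤ t := by exact_mod_cast hr
  simp [clip, h, min_eq_left this]

lemma strat_nonneg (q : ℝ≥0) (b h ε : ℝ) (hε : 0 < ε) (t : ℝ≥0) (ω : Omega) :
    0 ≤ elemCapital (strat q b h ε) ε t ω := by
  rw [strat_capital]
  by_cases h0 : hit q b (fun _ => 0) ω ≤ t
  · obtain ⟨r, hr, hv⟩ := (hit_le_iff continuous_const).1 h0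
    obtain ⟨a, ha, ham⟩ := hv.least continuous_const
    have hat : a ≤ t := (ham r hv).trans hr
    rw [clip_of_eq (hit_eq ha ham) hat]
    obtain ⟨s, h1, h2, h3, -⟩ := ha
    have hsa : s = a := le_antisymm h2 (ham s ⟨s, h1, le_rfl, h3, rfl⟩)
    subst hsa
    rw [h3]
    set c := clip (hit q b (gfun b h ε)) t ω with hc
    have hcle : (c : ℝ≥0∞) ≤ hit q b (gfun b h ε) ω := by
      rw [hc, clip, ENNReal.coe_toNNReal (by simp)]
      exact min_le_left _ _
    have hsc : s ≤ c := by
      have : (s : ℝ≥0∞) ≤ c := by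
        rw [hc, clip, ENNReal.coe_toNNReal (by simp)]
        refine le_min (le_iInf₂ fun r hr => ?_) (by exact_mod_cast hat)
        obtain ⟨s', k1, k2, k3, k4⟩ := hr
        exact_mod_cast ham r ⟨s', k1, k2, k3, rfl⟩
      exact_mod_cast this
    by_contra hneg
    push Not at hneg
    have hω := ω.2
    have hcont : ContinuousOn (fun x => h * (ω.1 x - b)) (Set.Icc s c) := by
      fun_prop
    obtain ⟨x, hx, hxe⟩ := intermediate_value_Icc' hsc hcont
      (show -ε ∈ Set.Icc _ _ from ⟨by linarith, by simp [h3, hε.le]⟩)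
    have hxc : (hit q b (gfun b h ε) ω) ≤ x := 
      iInf₂_le x ⟨s, h1, hx.1, h3, by simp only at hxe; simp [gfun, hxe]⟩
    have : c ≤ x := by exact_mod_cast hcle.trans hxc
    have : x = c := le_antisymm hx.2 this
    subst this
    simp only at hxe
    linarith
  · push Not at h0
    have h1 : (t : ℝ≥0∞) ≤ hit q b (gfun b h ε) ω :=
      h0.le.trans ((strat q b h ε).mono 0 ω)
    rw [clip_of_le h0.le, clip_of_le h1]
    simp [hε.le]

/-- The bad event. -/
def Bad (q : ℝ≥0) (b h : ℝ) (ω : Omega) : Prop :=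
  ∃ s, q ≤ s ∧ ω.1 s = b ∧ (∀ s', q ≤ s' → ω.1 s' = b → s ≤ s') ∧
    ∃ r, s ≤ r ∧ h * (ω.1 r - b) = 1 ∧ ∀ x, s ≤ x → x ≤ r → 0 ≤ h * (ω.1 x - b)

lemma strat_win {q : ℝ≥0} {b h ε : ℝ} (hε : 0 < ε) {ω : Omega} (hb : Bad q b h ω) :
    ∃ T : ℝ≥0, ∀ t, T ≤ t → 1 ≤ elemCapital (strat q b h ε) ε t ω := by
  obtain ⟨s, h1, h2, h3, r, h4, h5, h6⟩ := hb
  have e0 : hit q b (fun _ => 0) ω = s :=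
    hit_eq ⟨s, h1, le_rfl, h2, rfl⟩ (fun r' ⟨s', k1, k2, k3, _⟩ => (h3 s' k1 k3).trans k2)
  have hv : Vis q b (gfun b h ε) ω r := ⟨s, h1, h4, h2, by simp [gfun, h5]⟩
  obtain ⟨a, ha, ham⟩ := hv.least (gfun_cont b h ε)
  have e1 := hit_eq ha ham
  have har := ham r hv
  obtain ⟨s', k1, k2, k3, k4⟩ := ha
  have hsa : s ≤ a := (h3 s' k1 k3).trans k2
  have hpos := h6 a hsa har
  have hval : h * (ω.1 a - b) = 1 := by
    rcases mul_eq_zero.1 k4 with hh | hh <;> linarith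
  refine ⟨a, fun t ht => ?_⟩
  rw [strat_capital, clip_of_eq e1 ht, clip_of_eq e0 (hsa.trans ht), h2, hval]
  linarith

lemma exists_bad {b : ℝ} {ω : Omega} (h : ¬ Preperfect {t : ℝ≥0 | ω.1 t = b}) :
    ∃ (q : ℚ) (m : ℤ), Bad (Real.toNNReal q) b m ω := by
  have hω := ω.2
  simp only [Preperfect, not_forall] at h
  obtain ⟨x, hx, hacc⟩ := h
  rw [accPt_iff_frequently, not_frequently, Metric.eventually_nhds_iff] at hacc
  obtain ⟨δ, hδ, hball⟩ := hacc
  have hx : ω.1 x = b := hx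
  have hball' : ∀ y, dist y x < δ → ω.1 y = b → y = x := by
    intro y hy hyb
    by_contra hne
    exact hball hy ⟨hne, hyb⟩
  -- left endpoint
  obtain ⟨q, hqx, hq⟩ : ∃ q : ℚ, Real.toNNReal q ≤ x ∧
      ∀ s', Real.toNNReal q ≤ s' → ω.1 s' = b → x ≤ s' := by
    rcases eq_or_ne x 0 with rfl | hx0
    · exact ⟨0, by simp, fun s' _ _ => zero_le⟩
    · have hxp : (0:ℝ) < x := by exact_mod_cast pos_iff_ne_zero.2 hx0
      obtain ⟨q, hq1, hq2⟩ := exists_rat_btwn (show max 0 ((x:ℝ) - δ) < x from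
        max_lt hxp (by linarith))
      have hq0 : (0:ℝ) ≤ q := (le_max_left _ _).trans hq1.le
      have hqd : (x:ℝ) - δ < q := (le_max_right _ _).trans_lt hq1
      refine ⟨q, Real.toNNReal_le_iff_le_coe.2 hq2.le, fun s' hs' hb => ?_⟩
      by_contra hlt
      push Not at hlt
      have a1 := Real.toNNReal_le_iff_le_coe.1 hs'
      have a2 : (s' : ℝ) < x := by exact_mod_cast hlt
      have := hball' s' (by rw [NNReal.dist_eq, abs_lt]; constructor <;> linarith) hb
      exact hlt.ne this
  set y : ℝ≥0 := x + Real.toNNReal (δ / 2) with hy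
  have hyr : (y : ℝ) = x + δ / 2 := by
    rw [hy, NNReal.coe_add, Real.coe_toNNReal _ (by linarith)]
  have hxy : x ≤ y := by rw [hy]; exact le_self_add
  have hnear : ∀ z, x ≤ z → z ≤ y → ω.1 z = b → z = x := by
    intro z h1 h2 h3
    have a1 : (x : ℝ) ≤ z := by exact_mod_cast h1
    have a2 : (z : ℝ) ≤ y := by exact_mod_cast h2
    exact hball' z (by rw [NNReal.dist_eq, abs_lt]; constructor <;> linarith) h3
  have hyb : ω.1 y - b ≠ 0 := by
    intro h0
    have := hnear y hxy le_rfl (by linarith)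
    rw [this] at hyr
    linarith
  obtain ⟨m, hm⟩ : ∃ m : ℤ, 1 ≤ (m : ℝ) * (ω.1 y - b) := by
    rcases lt_or_gt_of_ne hyb with hd | hd
    · refine ⟨⌊1 / (ω.1 y - b)⌋, ?_⟩
      have := Int.floor_le (1 / (ω.1 y - b))
      rwa [le_div_iff_of_neg hd] at this
    · refine ⟨⌈1 / (ω.1 y - b)⌉, ?_⟩
      have := Int.le_ceil (1 / (ω.1 y - b))
      rwa [div_le_iff₀ hd] at this
  have hm0 : (m : ℝ) ≠ 0 := by
    intro h0
    rw [h0] at hm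
    linarith
  have hc : Continuous (fun z => (m : ℝ) * (ω.1 z - b)) := by fun_prop
  obtain ⟨r, hr, hre⟩ := intermediate_value_Icc hxy hc.continuousOn
    (show (1:ℝ) ∈ Set.Icc _ _ from ⟨by simp [hx], hm⟩)
  refine ⟨q, m, x, hqx, hx, hq, r, hr.1, hre, fun z hz1 hz2 => ?_⟩
  by_contra hneg
  push Not at hneg
  have hzy := hz2.trans hr.2
  obtain ⟨w, hw, hwe⟩ := intermediate_value_Icc hzy hc.continuousOn
    (show (0:ℝ) ∈ Set.Icc _ _ from ⟨hneg.le, by linarith⟩)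
  have hwb : ω.1 w = b := by
    rcases mul_eq_zero.1 hwe with h0 | h0
    · exact absurd h0 hm0
    · linarith
  have := hnear w (hz1.trans hw.1) hw.2 hwb
  have hzx : z = x := le_antisymm (hw.1.trans this.le) hz1
  rw [hzx, hx] at hneg
  simp at hneg

lemma perfect_of_preperfect {b : ℝ} {ω : Omega} (h : Preperfect {t : ℝ≥0 | ω.1 t = b}) :
    Perfect {t : ℝ≥0 | ω.1 t = b} ∧
      ({t : ℝ≥0 | ω.1 t = b} = ∅ ∨
        Cardinal.mk {t : ℝ≥0 | ω.1 t = b} = Cardinal.continuum) := by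
  have hp : Perfect {t : ℝ≥0 | ω.1 t = b} := ⟨isClosed_eq ω.2 continuous_const, h⟩
  refine ⟨hp, ?_⟩
  rcases Set.eq_empty_or_nonempty {t : ℝ≥0 | ω.1 t = b} with he | hne
  · exact Or.inl he
  · right
    apply le_antisymm
    · rw [← Cardinal.mk_real]
      exact Cardinal.mk_le_of_injective
        (f := fun t : {t : ℝ≥0 | ω.1 t = b} => ((t.1 : ℝ≥0) : ℝ))
        (fun a c hac => Subtype.ext (NNReal.coe_injective hac))
    · obtain ⟨f, hf, -, hinj⟩ := hp.exists_nat_bool_injection hne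
      have : Cardinal.mk (ℕ → Bool) = Cardinal.continuum := by simp
      rw [← this]
      exact Cardinal.mk_le_of_injective
        (f := fun x => (⟨f x, hf ⟨x, rfl⟩⟩ : {t : ℝ≥0 | ω.1 t = b}))
        (fun a c hac => hinj (congrArg Subtype.val hac))

noncomputable def idx : ℕ → ℚ × ℤ := (exists_surjective_nat (ℚ × ℤ)).choose

lemma idx_surj (x : ℚ × ℤ) : ∃ n, idx n = x :=
  (exists_surjective_nat (ℚ × ℤ)).choose_spec x

noncomputable def proc (b δ : ℝ) (hδ : 0 < δ) : PosCapital where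
  G := fun n => strat (Real.toNNReal (idx n).1) b (idx n).2 (δ / 2 / 2 ^ n)
  c := fun n => δ / 2 / 2 ^ n
  c_pos := fun n => by positivity
  c_summable := summable_geometric_two' δ
  nonneg := fun n t ω => strat_nonneg _ _ _ _ (by positivity) t ω

lemma proc_win {b δ : ℝ} (hδ : 0 < δ) {q : ℚ} {m : ℤ} {ω : Omega}
    (hbad : Bad (Real.toNNReal q) b m ω) :
    ∃ T : ℝ≥0, ∀ t, T ≤ t → 1 ≤ (proc b δ hδ).value t ω := by
  obtain ⟨n, hn⟩ := idx_surj (q, m)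
  have hbad' : Bad (Real.toNNReal (idx n).1) b (idx n).2 ω := by rw [hn]; exact hbad
  obtain ⟨T, hT⟩ := strat_win (ε := δ / 2 / 2 ^ n) (by positivity) hbad'
  refine ⟨T, fun t ht => ?_⟩
  have h1 := hT t ht
  have h2 : (1 : ℝ≥0∞) ≤
      ENNReal.ofReal (elemCapital ((proc b δ hδ).G n) ((proc b δ hδ).c n) t ω) :=
    ENNReal.one_le_ofReal.2 h1
  exact h2.trans (ENNReal.le_tsum (f := fun n =>
    ENNReal.ofReal (elemCapital ((proc b δ hδ).G n) ((proc b δ hδ).c n) t ω)) n)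

lemma proc_start (b δ : ℝ) (hδ : 0 < δ) : (proc b δ hδ).init = ENNReal.ofReal δ := by
  unfold PosCapital.init
  rw [← ENNReal.ofReal_tsum_of_nonneg (fun n => ((proc b δ hδ).c_pos n).le)
    (proc b δ hδ).c_summable]
  congr 1
  exact tsum_geometric_two' δ

/-- for each `b ∈ ℝ`, it is almost certain that the level set
`L_ω(b)` is perfect (closed with no isolated points), and hence either empty or
of the cardinality of the continuum: the set of `ω` where this fails is null. -/
theorem levelSet_perfect (b : ℝ) :
    IsNull {ω : Omega | ¬ (Perfect {t : ℝ≥0 | ω.1 t = b} ∧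
      ({t : ℝ≥0 | ω.1 t = b} = ∅ ∨
        Cardinal.mk {t : ℝ≥0 | ω.1 t = b} = Cardinal.continuum))} := by
  unfold IsNull
  rw [← nonpos_iff_eq_zero]
  refine ENNReal.le_of_forall_pos_le_add fun ε hε _ => ?_
  rw [zero_add]
  have hε' : (0 : ℝ) < ε := by exact_mod_cast hε
  have hstart := proc_start b ε hε'
  rw [ENNReal.ofReal_coe_nnreal] at hstart
  rw [← hstart]
  refine iInf₂_le (proc b ε hε') fun ω => ?_
  refine Set.indicator_apply_le' (fun hω => ?_) (fun _ => zero_le)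
  have hnp : ¬ Preperfect {t : ℝ≥0 | ω.1 t = b} := fun h => hω (perfect_of_preperfect h)
  obtain ⟨q, m, hbad⟩ := exists_bad hnp
  obtain ⟨T, hT⟩ := proc_win hε' hbad
  refine le_liminf_of_le (by isBoundedDefault) ?_
  filter_upwards [eventually_ge_atTop T] with t ht
  exact hT t ht

end GTP
end

section
/- Let b ∈ ℝ. The event {ω ∈ Ω : the level set L_ω(b) := {t ∈ [0,∞) : ω(t) = b} is unbounded} is completely uncertain, i.e. both this event and its complement have upper probability 1. -/
open Filter Topology MeasureTheory
open scoped ENNReal NNReal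

namespace GTP

/-- The trivial strategy that never holds any position. -/
noncomputable def zeroStrategy : ElemStrategy where
  τ := fun n _ => (n : ℝ≥0∞)
  stopping := fun n t => MeasurableSet.const _
  mono := fun n _ => by exact_mod_cast Nat.le_succ n
  tendsto_top := fun _ => ENNReal.tendsto_nat_nhds_top
  h := fun _ _ => 0
  h_bdd := fun _ => ⟨0, fun _ => by simp⟩
  h_meas := fun n B _ t => by
    have h : ((fun _ : Omega => (0 : ℝ)) ⁻¹' B ∩ {_ω : Omega | (n : ℝ≥0∞) ≤ (t : ℝ≥0∞)})
        = {_ω : Omega | (0 : ℝ) ∈ B ∧ (n : ℝ≥0∞) ≤ (t : ℝ≥0∞)} := by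
      ext ω; simp
    rw [h]
    exact MeasurableSet.const _

theorem elemCapital_zero (c : ℝ) (t : ℝ≥0) (ω : Omega) :
    elemCapital zeroStrategy c t ω = c := by
  simp [elemCapital, zeroStrategy]

/-- The constant positive capital process with initial value `1`. -/
noncomputable def unitCapital : PosCapital where
  G := fun _ => zeroStrategy
  c := fun n => 1 / 2 / 2 ^ n
  c_pos := fun n => by positivity
  c_summable := summable_geometric_two' 1
  nonneg := fun n t ω => by
    rw [elemCapital_zero]
    positivity

theorem unitCapital_init : unitCapital.init = 1 := by
  have h : (∑' n : ℕ, (1 : ℝ) / 2 / 2 ^ n) = 1 := tsum_geometric_two' 1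
  unfold PosCapital.init
  rw [← ENNReal.ofReal_tsum_of_nonneg (fun n => (unitCapital.c_pos n).le) unitCapital.c_summable]
  change ENNReal.ofReal (∑' n : ℕ, (1 : ℝ) / 2 / 2 ^ n) = 1
  rw [h, ENNReal.ofReal_one]

theorem unitCapital_value (t : ℝ≥0) (ω : Omega) : unitCapital.value t ω = 1 := by
  rw [← unitCapital_init]
  unfold PosCapital.value PosCapital.init
  refine tsum_congr fun n => ?_
  change ENNReal.ofReal (elemCapital zeroStrategy _ t ω) = _
  rw [elemCapital_zero]

theorem UpProb_le_one (E : Set Omega) : UpProb E ≤ 1 := by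
  rw [← unitCapital_init]
  refine iInf₂_le unitCapital fun ω => ?_
  simp only [unitCapital_value, liminf_const]
  exact Set.indicator_le_self' (fun _ _ => zero_le_one) ω

/-- The constant path with value `a`. -/
def constPath (a : ℝ) : Omega := ⟨fun _ => a, continuous_const⟩

theorem value_constPath (S : PosCapital) (t : ℝ≥0) (a : ℝ) :
    S.value t (constPath a) = S.init := by
  simp [PosCapital.value, PosCapital.init, elemCapital, constPath]

/-- No strategy makes money on a constant path. -/
theorem UpProb_eq_one_of_constPath_mem {E : Set Omega} (a : ℝ) (h : constPath a ∈ E) :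
    UpProb E = 1 := by
  refine le_antisymm (UpProb_le_one E) (le_iInf₂ fun S hS => ?_)
  simpa [value_constPath, h] using hS (constPath a)

/-- the event that the level set `L_ω(b)` is unbounded is
completely uncertain. -/
theorem levelSet_unbounded_completely_uncertain (b : ℝ) :
    UpProb {ω : Omega | ¬ BddAbove {t : ℝ≥0 | ω.1 t = b}} = 1 ∧
      UpProb {ω : Omega | ¬ BddAbove {t : ℝ≥0 | ω.1 t = b}}ᶜ = 1 := by
  constructor
  · apply UpProb_eq_one_of_constPath_mem b
    change ¬ BddAbove {_t : ℝ≥0 | b = b}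
    simp
  · apply UpProb_eq_one_of_constPath_mem (b + 1)
    change ¬ ¬ BddAbove {_t : ℝ≥0 | b + 1 = b}
    simp

end GTP
end
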